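/- Identity (F): with the notation of the Sturm coefficient determinants, for all n ≥ 3 and all i, c(n-1)_i·c(n)² - c(n-1)·c(n)·c(n)_i - c(n-1)_1·c(n)_{i-1}·c(n) + c(n-1)·c(n)_1·c(n)_{i-1} = -c(n-1)²·c(n+1)_{i-2}, where the c(m)_i are the determinants of the shifted (m-1)×(m-1) matrices C(m)_i built from generators b(j)_i satisfying the quadratic relations (2.1.1). -/

import Mathlib

/-- The shifted `(m-1)×(m-1)` Hankel-type matrix `C(m)_i` built from generators `b`:
`(p,q)`-entry `b(min(p,q))_{p+q}` for `p ≤ m-2` (1-based), last row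
`(b(1)_{m+i}, …, b(m-1)_{2m+i-2})`. -/
def bCMat {R : Type*} [CommRing R] (b : ℤ → ℤ → R) (m : ℕ) (i : ℤ) :
    Matrix (Fin (m - 1)) (Fin (m - 1)) R :=
  Matrix.of fun p q =>
    if p.1 = m - 2 then b ((q.1 : ℤ) + 1) ((m : ℤ) + i + q.1)
    else b ((min (p.1 + 1) (q.1 + 1) : ℕ) : ℤ) ((p.1 : ℤ) + q.1 + 2)

/-- `c(m)_i = det C(m)_i`. -/
def bC {R : Type*} [CommRing R] (b : ℤ → ℤ → R) (m : ℕ) (i : ℤ) : R :=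
  (bCMat b m i).det

namespace Matrix

variable {R : Type*} [CommRing R]

theorem det_eq_zero_of_proportional_columns {n : Type*} [Fintype n] [DecidableEq n]
    (M : Matrix n n R) {i j : n} (hij : i ≠ j)
    (h : ∀ p p', M p i * M p' j = M p' i * M p j) : M.det = 0 := by
  rw [det_apply]
  refine Finset.sum_involution (fun σ _ => σ * Equiv.swap i j) (fun σ _ => ?_) (fun σ _ _ => ?_)
    (fun _ _ => Finset.mem_univ _) (fun σ _ => by simp [mul_assoc])
  · have key : ∏ x, M ((σ * Equiv.swap i j) x) x = ∏ x, M (σ x) x := by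
      have hj : j ∈ Finset.univ.erase i := by simp [hij.symm]
      rw [← Finset.mul_prod_erase _ _ (Finset.mem_univ i),
        ← Finset.mul_prod_erase _ (fun x => M (σ x) x) (Finset.mem_univ i),
        ← Finset.mul_prod_erase _ _ hj, ← Finset.mul_prod_erase _ (fun x => M (σ x) x) hj,
        ← mul_assoc, ← mul_assoc]
      congr 1
      · simp [h (σ j) (σ i)]
      · refine Finset.prod_congr rfl fun x hx => ?_
        simp only [Finset.mem_erase, Finset.mem_univ, and_true] at hx
        simp [Equiv.swap_apply_of_ne_of_ne hx.2 hx.1]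
    rw [key, Equiv.Perm.sign_mul, Equiv.Perm.sign_swap hij]
    simp
  · intro he
    exact hij (Equiv.swap_eq_one_iff.mp (mul_eq_left.mp he))

theorem sum_adjugate_mul_eq_det_updateCol {n : Type*} [Fintype n] [DecidableEq n]
    (A : Matrix n n R) (i : n) (v : n → R) :
    ∑ p, A.adjugate i p * v p = (A.updateCol i v).det := by
  rw [← cramer_apply, cramer_eq_adjugate_mulVec]
  rfl

theorem sum_mul_adjugate_eq_det_updateRow {n : Type*} [Fintype n] [DecidableEq n]
    (A : Matrix n n R) (i : n) (v : n → R) :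
    ∑ q, v q * A.adjugate q i = (A.updateRow i v).det := by
  rw [← cramer_transpose_apply, cramer_eq_adjugate_mulVec, ← adjugate_transpose]
  exact Finset.sum_congr rfl fun q _ => mul_comm _ _

theorem det_eq_bordered {n : ℕ} (K : Matrix (Fin (n + 2)) (Fin (n + 2)) R) :
    K.det = K (Fin.last _) (Fin.last _) * (K.submatrix Fin.castSucc Fin.castSucc).det -
      ∑ q : Fin (n + 1), K (Fin.last _) q.castSucc * ∑ p : Fin (n + 1),
        (K.submatrix Fin.castSucc Fin.castSucc).adjugate q p * K p.castSucc (Fin.last _) := by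
  rw [det_succ_row K (Fin.last _), Fin.sum_univ_castSucc, add_comm, sub_eq_add_neg,
    ← Finset.sum_neg_distrib]
  congr 1
  · simp [← two_mul, pow_mul, Fin.succAbove_last]
  · refine Finset.sum_congr rfl fun q _ => ?_
    rw [det_succ_column _ (Fin.last _), Finset.mul_sum, Finset.mul_sum, ← Finset.sum_neg_distrib]
    refine Finset.sum_congr rfl fun p _ => ?_
    rw [adjugate_fin_succ_eq_det_submatrix, submatrix_submatrix, submatrix_submatrix]
    have h1 : (q.castSucc.succAbove ∘ (Fin.last n).succAbove : Fin n → Fin (n + 2)) =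
        Fin.castSucc ∘ q.succAbove := by
      ext x
      simp [Fin.succAbove_last]
    have h2 : q.castSucc.succAbove (Fin.last n) = Fin.last (n + 1) := by
      simp
    rw [h1]
    simp only [submatrix_apply, h2, Fin.succAbove_last, Fin.val_last, Fin.val_castSucc]
    have h3 : ((-1 : R)) ^ (n + 1 + (q : ℕ)) * (-1) ^ ((p : ℕ) + n) = -(-1) ^ ((p : ℕ) + q) := by
      have h4 : ((-1 : R)) ^ n * (-1) ^ n = 1 := by simp [← mul_pow]
      simp only [pow_add, pow_one]
      linear_combination (-1 : R) ^ (q : ℕ) * (-1) ^ (p : ℕ) * (-1) * h4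
    linear_combination (K (Fin.last (n + 1)) q.castSucc * K p.castSucc (Fin.last (n + 1)) *
      (K.submatrix (Fin.castSucc ∘ p.succAbove) (Fin.castSucc ∘ q.succAbove)).det) * h3

/-- A consequence of Jacobi's identity for the complementary `2 × 2` minors of the adjugate. -/
theorem det_leading_updateRow_mul_det {m : ℕ} (A : Matrix (Fin (m + 2)) (Fin (m + 2)) R)
    (w : Fin (m + 2) → R) :
    ((A.submatrix Fin.castSucc Fin.castSucc).updateRow (Fin.last m)
        fun q => w q.castSucc).det * A.det =
      A.adjugate (Fin.last _) (Fin.last _) *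
          ∑ q, w q * A.adjugate q (Fin.last m).castSucc +
        ((A.submatrix Fin.castSucc Fin.castSucc).updateRow (Fin.last m)
          fun q => A (Fin.last _) q.castSucc).det * ∑ q, w q * A.adjugate q (Fin.last _) := by
  set k : Fin (m + 2) := (Fin.last m).castSucc with hk
  set l : Fin (m + 2) := Fin.last (m + 1) with hl
  have hkl : k ≠ l := (Fin.castSucc_lt_last _).ne
  set M := A.updateRow l (Pi.single l 1) with hM
  have hφ (v : Fin (m + 2) → R) : ((A.submatrix Fin.castSucc Fin.castSucc).updateRow (Fin.last m)
      fun q => v q.castSucc).det = ∑ q, v q * M.adjugate q k := by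
    rw [sum_mul_adjugate_eq_det_updateRow, hM, updateRow_comm _ hkl.symm, ← adjugate_apply,
      adjugate_fin_succ_eq_det_submatrix]
    simp only [hl, Fin.succAbove_last, ← two_mul, pow_mul, neg_one_sq, one_pow, one_mul]
    congr 1
    ext p q
    simp only [updateRow_apply, submatrix_apply, hk, Fin.castSucc_inj]
  have hdet : M.det = A.adjugate l l := (adjugate_apply A l l).symm
  have hrow (p : Fin (m + 2)) : ∑ q, A p q * M.adjugate q k =
      (if p = k then A.adjugate l l else 0) +
        (if p = l then ∑ q, A l q * M.adjugate q k else 0) := by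
    by_cases hp : p = l
    · rw [hp, if_neg hkl.symm, if_pos rfl, zero_add]
    · have hMp (x : Fin (m + 2)) : A p x = M p x := by rw [hM, updateRow_ne hp]
      have := congrFun₂ (mul_adjugate M) p k
      simpa [mul_apply, hMp, hp, hdet, one_apply] using this
  have hy (q : Fin (m + 2)) : A.det * M.adjugate q k = A.adjugate q k * A.adjugate l l +
      A.adjugate q l * ∑ q, A l q * M.adjugate q k := by
    have h1 : (A.adjugate * A * M.adjugate) q k = A.det * M.adjugate q k := by
      simp [adjugate_mul]
    rw [← h1, Matrix.mul_assoc, mul_apply]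
    have h2 (p : Fin (m + 2)) : (A * M.adjugate) p k = ∑ x, A p x * M.adjugate x k := mul_apply
    generalize ∑ q, A l q * M.adjugate q k = f at hrow ⊢
    simp only [h2, hrow, mul_add, Finset.sum_add_distrib, mul_ite, mul_zero,
      Finset.sum_ite_eq', Finset.mem_univ, if_true]
  rw [hφ, hφ, Finset.sum_mul, Finset.mul_sum, Finset.mul_sum, ← Finset.sum_add_distrib]
  refine Finset.sum_congr rfl fun q _ => ?_
  linear_combination w q * hy q

/-- If the displacement `B p (q + 1) - B (p + 1) q` behaves like an alternating form of rank two
whose kernel relation involves the first column of `B`, the cofactors of the two last rows of a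
leading block satisfy a linear relation along any further row `w` with successor `w'`. -/
theorem displacement_cofactor_relation {m : ℕ} (B : ℕ → ℕ → R) (w w' : ℕ → R)
    (hB : ∀ p q, B p q = B q p)
    (hT : ∀ p p' q, B p 0 * (B p' (q + 1) - B (p' + 1) q) =
      B q 0 * (B p' (p + 1) - B (p' + 1) p) + B p' 0 * (B p (q + 1) - B (p + 1) q))
    (hw : ∀ p q, B p 0 * (w (q + 1) - w' q) =
      B q 0 * (w (p + 1) - w' p) + w 0 * (B p (q + 1) - B (p + 1) q))
    (A : Matrix (Fin (m + 2)) (Fin (m + 2)) R) (hA : ∀ p q, A p q = B p q) :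
    A.det * (∑ q : Fin (m + 2), w q * A.adjugate q (Fin.last m).castSucc -
          ∑ q : Fin (m + 2), w' q * A.adjugate q (Fin.last _)) +
        (∑ q : Fin (m + 2), B (m + 2) q * A.adjugate q (Fin.last _)) *
          (∑ q : Fin (m + 2), w q * A.adjugate q (Fin.last _)) +
        A.adjugate (Fin.last _) (Fin.last _) *
          (w (m + 2) * A.det - ∑ q : Fin (m + 2), w q *
            ∑ p : Fin (m + 2), A.adjugate q p * B p (m + 2)) = 0 := by
  set l : Fin (m + 2) := Fin.last (m + 1) with hl
  set k : Fin (m + 2) := (Fin.last m).castSucc with hk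
  set c : Fin (m + 2) → R := fun q => A.adjugate q l with hc
  set Y := ∑ q : Fin (m + 2), B (m + 2) q * A.adjugate q l with hY
  have hmul (p q : Fin (m + 2)) : ∑ x : Fin (m + 2), B p x * A.adjugate x q =
      if p = q then A.det else 0 := by
    have := congrFun₂ (mul_adjugate A) p q
    simpa [mul_apply, hA, one_apply] using this
  have hmul' (p q : Fin (m + 2)) : ∑ x : Fin (m + 2), A.adjugate p x * B x q =
      if p = q then A.det else 0 := by
    have := congrFun₂ (adjugate_mul A) p q
    simpa [mul_apply, hA, one_apply] using this
  have hR : ∑ q : Fin (m + 2), B q 0 * c q = 0 := by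
    have := hmul 0 l
    rw [if_neg (Fin.last_pos).ne] at this
    simpa [hB 0] using this
  let G : ℕ → R := fun p => ∑ q : Fin (m + 2), (B p (q + 1) - B (p + 1) q) * c q
  let g : R := ∑ q : Fin (m + 2), (w (q + 1) - w' q) * c q
  have hG (p p' : ℕ) : B p 0 * G p' = B p' 0 * G p := by
    have : B p 0 * G p' = (B p' (p + 1) - B (p' + 1) p) * (∑ q : Fin (m + 2), B q 0 * c q) +
        B p' 0 * G p := by
      simp only [G, Finset.mul_sum, ← Finset.sum_add_distrib]
      exact Finset.sum_congr rfl fun q _ => by linear_combination c q * hT p p' q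
    rw [this, hR, mul_zero, zero_add]
  have hg (p : ℕ) : B p 0 * g = w 0 * G p := by
    have : B p 0 * g = (w (p + 1) - w' p) * (∑ q : Fin (m + 2), B q 0 * c q) +
        w 0 * G p := by
      simp only [G, g, Finset.mul_sum, ← Finset.sum_add_distrib]
      exact Finset.sum_congr rfl fun q _ => by linear_combination c q * hw p q
    rw [this, hR, mul_zero, zero_add]
  have hz (q : Fin (m + 2)) (hq : q ≠ 0) : ∑ p : Fin (m + 2), A.adjugate q p * G p = 0 := by
    rw [sum_adjugate_mul_eq_det_updateCol]
    refine det_eq_zero_of_proportional_columns _ hq.symm fun p p' => ?_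
    simpa [updateCol_apply, hq.symm, hA] using hG p p'
  have hD : A.det * g = w 0 * ∑ p : Fin (m + 2), A.adjugate 0 p * G p := by
    have h0 := hmul' 0 0
    rw [if_pos rfl] at h0
    rw [← h0, Finset.sum_mul, Finset.mul_sum]
    refine Finset.sum_congr rfl fun p _ => ?_
    have := hg p
    simp only [Fin.val_zero]
    linear_combination A.adjugate 0 p * this
  have hsum : ∑ q : Fin (m + 2), w q * ∑ p : Fin (m + 2), A.adjugate q p * G p = A.det * g := by
    rw [hD]
    refine Finset.sum_eq_single 0 (fun q _ hq => by rw [hz q hq, mul_zero]) (by simp)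
  have hGp (p : Fin (m + 2)) : G p = ∑ x : Fin (m + 1), B p (x + 1) * c x.castSucc +
      B p (m + 2) * c l - ((if p = k then A.det else 0) + if p = l then Y else 0) := by
    simp only [G, sub_mul, Finset.sum_sub_distrib]
    congr 1
    · rw [Fin.sum_univ_castSucc]
      simp [hl]
    · refine Fin.lastCases ?_ (fun p => ?_) p
      · have : Fin.last (m + 1) ≠ k := (Fin.castSucc_lt_last _).ne'
        simp [hl, this, hY, hc]
      · have h1 := hmul p.succ l
        have h2 : p.castSucc ≠ l := (Fin.castSucc_lt_last _).ne
        have h3 : p.succ = l ↔ p.castSucc = k := by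
          rw [hl, hk, ← Fin.succ_last, Fin.succ_inj, Fin.castSucc_inj]
        simp only [h3] at h1
        simpa [h2, hc] using h1
  have hadj (q : Fin (m + 2)) : ∑ p : Fin (m + 2), A.adjugate q p * G p =
      A.det * (∑ x : Fin (m + 1), if q = x.succ then c x.castSucc else 0) +
        (∑ p : Fin (m + 2), A.adjugate q p * B p (m + 2)) * c l -
        (A.adjugate q k * A.det + c q * Y) := by
    simp only [hGp, mul_sub, mul_add, Finset.sum_sub_distrib, Finset.sum_add_distrib, mul_ite,
      mul_zero, Finset.sum_ite_eq', Finset.mem_univ, if_true]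
    congr 2
    · simp only [Finset.mul_sum]
      rw [Finset.sum_comm]
      refine Finset.sum_congr rfl fun x _ => ?_
      have := hmul' q x.succ
      simp only [Fin.val_succ] at this
      simp only [← mul_assoc, ← Finset.sum_mul, this]
      split_ifs <;> simp
    · simp only [Finset.sum_mul, mul_assoc]
  have hshift : ∑ q : Fin (m + 2), w q * (∑ x : Fin (m + 1), if q = x.succ then c x.castSucc else 0)
      = ∑ x : Fin (m + 1), w (x + 1) * c x.castSucc := by
    simp only [Finset.mul_sum]
    rw [Finset.sum_comm]
    refine Finset.sum_congr rfl fun x _ => ?_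
    simp
  have hg' : g = ∑ x : Fin (m + 1), w (x + 1) * c x.castSucc + w (m + 2) * c l -
      ∑ q : Fin (m + 2), w' q * c q := by
    simp only [g, sub_mul, Finset.sum_sub_distrib]
    rw [Fin.sum_univ_castSucc]
    simp [hl]
  have hsum' : ∑ q : Fin (m + 2), w q * ∑ p : Fin (m + 2), A.adjugate q p * G p =
      A.det * (∑ x : Fin (m + 1), w (x + 1) * c x.castSucc) +
      (∑ q : Fin (m + 2), w q * ∑ p : Fin (m + 2), A.adjugate q p * B p (m + 2)) * c l -
      ((∑ q : Fin (m + 2), w q * A.adjugate q k) * A.det +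
        (∑ q : Fin (m + 2), w q * c q) * Y) := by
    rw [← hshift, Finset.mul_sum, Finset.sum_mul, Finset.sum_mul, Finset.sum_mul,
      ← Finset.sum_add_distrib, ← Finset.sum_add_distrib, ← Finset.sum_sub_distrib]
    refine Finset.sum_congr rfl fun q _ => ?_
    rw [hadj]
    ring
  simp only [hc] at hsum' hg'
  linear_combination hsum' - hsum - A.det * hg'

end Matrix

/-- The symmetric infinite matrix with `(p, q)`-entry `b(min(p, q))_{p+q}`, indexed from zero. -/
def bSymm {R : Type*} (b : ℤ → ℤ → R) (p q : ℕ) : R :=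
  b ((min p q : ℕ) + 1) (p + q + 2)

section

variable {R : Type*} (b : ℤ → ℤ → R)

theorem bSymm_comm (p q : ℕ) : bSymm b p q = bSymm b q p := by
  rw [bSymm, bSymm, min_comm, add_comm (p : ℤ)]

theorem bSymm_zero (p : ℕ) : bSymm b p 0 = b 1 (p + 2) := by
  simp [bSymm]

theorem bSymm_of_le {p q : ℕ} (h : q ≤ p) : bSymm b p q = b (q + 1) (p + q + 2) := by
  simp [bSymm, min_eq_right h]

variable [CommRing R]

/-- The increment `b(j)_{j+k-1} - b(j-1)_{j+k-1}`. -/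
def bIncr (j k : ℤ) : R := b j (j + k - 1) - b (j - 1) (j + k - 1)

variable {b} (hrel : ∀ i j k : ℤ,
  (b 1 j * b (k - 1) i - b 1 k * b (j - 1) (i + j - k))
    - (b 1 j * b k i - b (j - 1) (j + k - 1) * b 1 (i - k + 1))
    + (b 1 k * b j (i + j - k) - b j (j + k - 1) * b 1 (i - k + 1)) = 0)

include hrel

theorem bIncr_cyclic (j k l : ℤ) :
    b 1 j * bIncr b k l - b 1 k * bIncr b j l + b 1 l * bIncr b j k = 0 := by
  have h := hrel (k + l - 1) j k
  rw [show k + l - 1 + j - k = j + l - 1 by ring, show k + l - 1 - k + 1 = l by ring] at h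
  simp only [bIncr]
  linear_combination -h

theorem mul_bIncr_swap (j k l : ℤ) : b 1 l * bIncr b j k = -(b 1 l * bIncr b k j) := by
  linear_combination bIncr_cyclic hrel j k l + bIncr_cyclic hrel k j l

theorem mul_bIncr_self (j l : ℤ) : b 1 l * bIncr b j j = 0 := by
  linear_combination bIncr_cyclic hrel j j l

theorem mul_bSymm_displacement (l : ℤ) (p q : ℕ) :
    b 1 l * (bSymm b p (q + 1) - bSymm b (p + 1) q) = b 1 l * bIncr b (q + 2) (p + 2) := by
  rcases lt_trichotomy q p with h | rfl | h
  · rw [bSymm_of_le b (show q + 1 ≤ p by omega), bSymm_of_le b (show q ≤ p + 1 by omega), bIncr]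
    push_cast
    ring_nf
  · rw [mul_bIncr_self hrel, bSymm_comm, sub_self, mul_zero]
  · rw [mul_bIncr_swap hrel, bSymm_comm b p, bSymm_comm b (p + 1),
      bSymm_of_le b (show p ≤ q + 1 by omega), bSymm_of_le b (show p + 1 ≤ q by omega), bIncr]
    push_cast
    ring_nf

theorem bSymm_displacement (p p' q : ℕ) :
    bSymm b p 0 * (bSymm b p' (q + 1) - bSymm b (p' + 1) q) =
      bSymm b q 0 * (bSymm b p' (p + 1) - bSymm b (p' + 1) p) +
        bSymm b p' 0 * (bSymm b p (q + 1) - bSymm b (p + 1) q) := by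
  simp only [bSymm_zero, mul_bSymm_displacement hrel]
  linear_combination bIncr_cyclic hrel (p + 2) (q + 2) (p' + 2) -
    mul_bIncr_swap hrel (q + 2) (p + 2) (p' + 2)

theorem row_displacement (s : ℤ) (p q : ℕ) :
    bSymm b p 0 * (b (q + 2) (s + q + 2) - b (q + 1) (s + q + 2)) =
      bSymm b q 0 * (b (p + 2) (s + p + 2) - b (p + 1) (s + p + 2)) +
        b 1 (s + 1) * (bSymm b p (q + 1) - bSymm b (p + 1) q) := by
  have key (x : ℕ) : b (x + 2) (s + x + 2) - b (x + 1) (s + x + 2) = bIncr b (x + 2) (s + 1) := by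
    rw [bIncr]
    ring_nf
  simp only [bSymm_zero, mul_bSymm_displacement hrel, key]
  linear_combination bIncr_cyclic hrel (p + 2) (q + 2) (s + 1) -
    mul_bIncr_swap hrel (q + 2) (p + 2) (s + 1)

end

/-- The leading `(m+1) × (m+1)` block of `bSymm b`. -/
def bLead {R : Type*} (b : ℤ → ℤ → R) (m : ℕ) : Matrix (Fin (m + 1)) (Fin (m + 1)) R :=
  Matrix.of fun p q => bSymm b p q

section

variable {R : Type*} (b : ℤ → ℤ → R)

theorem bLead_submatrix_castSucc (m : ℕ) :
    (bLead b (m + 1)).submatrix Fin.castSucc Fin.castSucc = bLead b m := rfl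

variable [CommRing R]

theorem bC_eq_det_updateRow (m : ℕ) (i : ℤ) :
    bC b (m + 2) i = ((bLead b m).updateRow (Fin.last m) fun q =>
      b ((q : ℕ) + 1) (m + 1 + i + (q : ℕ) + 1)).det := by
  rw [bC]
  refine congrArg Matrix.det (Matrix.ext fun p q => ?_)
  change Fin (m + 1) at p q
  simp only [bCMat, Matrix.of_apply, Matrix.updateRow_apply, bLead, bSymm, Fin.ext_iff,
    Fin.val_last, Nat.add_sub_cancel]
  split_ifs
  · push_cast
    ring_nf
  · push_cast
    rw [min_add_add_right]

theorem bC_zero (m : ℕ) : bC b (m + 2) 0 = (bLead b m).det := by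
  rw [bC_eq_det_updateRow]
  congr 1
  refine (congrArg _ (funext fun q => ?_)).trans (Matrix.updateRow_eq_self _ (Fin.last m))
  rw [bLead, Matrix.of_apply, bSymm_of_le b (by simp; omega)]
  simp only [Fin.val_last]
  ring_nf

end

/-- Identity (F): in any commutative ring with elements `b(i)_j` (`i,j ∈ ℤ`) satisfying
the quadratic relations (2.1.1), one has, for all `n ≥ 3` and all `i ∈ ℤ`,
`c(n-1)_i·c(n)² - c(n-1)·c(n)·c(n)_i - c(n-1)₁·c(n)_{i-1}·c(n) + c(n-1)·c(n)₁·c(n)_{i-1}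
  = -c(n-1)²·c(n+1)_{i-2}`. -/
theorem identity_F {R : Type*} [CommRing R] (b : ℤ → ℤ → R)
    (hrel : ∀ i j k : ℤ,
      (b 1 j * b (k - 1) i - b 1 k * b (j - 1) (i + j - k))
        - (b 1 j * b k i - b (j - 1) (j + k - 1) * b 1 (i - k + 1))
        + (b 1 k * b j (i + j - k) - b j (j + k - 1) * b 1 (i - k + 1)) = 0)
    (n : ℕ) (hn : 3 ≤ n) (i : ℤ) :
    bC b (n - 1) i * (bC b n 0) ^ 2 - bC b (n - 1) 0 * bC b n 0 * bC b n i
        - bC b (n - 1) 1 * bC b n (i - 1) * bC b n 0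
        + bC b (n - 1) 0 * bC b n 1 * bC b n (i - 1)
      = -(bC b (n - 1) 0) ^ 2 * bC b (n + 1) (i - 2) := by
 
  obtain ⟨m, rfl⟩ : ∃ m, n = m + 3 := ⟨n - 3, by omega⟩
  rw [show m + 3 - 1 = m + 2 from rfl, show m + 3 = (m + 1) + 2 from rfl,
    show m + 1 + 2 + 1 = (m + 2) + 2 from rfl]
  set A := bLead b (m + 1) with hA
  set s : ℤ := m + 1 + i with hs
  set w : ℕ → R := fun q => b (q + 1) (s + q + 1) with hw
  set w' : ℕ → R := fun q => b (q + 1) (s + q + 2) with hw'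
  have key := Matrix.displacement_cofactor_relation (m := m) (bSymm b) w w' (bSymm_comm b)
    (bSymm_displacement hrel) (fun p q => by
      have := row_displacement hrel s p q
      simp only [hw, hw']
      push_cast
      convert this using 3 <;> ring_nf) A (fun _ _ => rfl)
  have hlead : bC b (m + 2) 0 = A.adjugate (Fin.last _) (Fin.last _) := by
    rw [bC_zero, Matrix.adjugate_fin_succ_eq_det_submatrix]
    simp only [Fin.succAbove_last, ← two_mul, pow_mul, neg_one_sq, one_pow, one_mul]
    rfl
  have hdet : bC b (m + 1 + 2) 0 = A.det := bC_zero b (m + 1)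
  have hrow (j : ℤ) (v : ℕ → R) (hv : ∀ q : ℕ, v q = b (q + 1) (m + 2 + j + q + 1)) :
      bC b (m + 1 + 2) j = ∑ q : Fin (m + 2), v q * A.adjugate q (Fin.last _) := by
    rw [Matrix.sum_mul_adjugate_eq_det_updateRow, bC_eq_det_updateRow]
    congr 2
    ext q
    rw [hv]
    push_cast
    ring_nf
  have hi : bC b (m + 1 + 2) i = ∑ q : Fin (m + 2), w' q * A.adjugate q (Fin.last _) :=
    hrow i w' fun q => by simp only [hw', hs]; ring_nf
  have hi1 : bC b (m + 1 + 2) (i - 1) = ∑ q : Fin (m + 2), w q * A.adjugate q (Fin.last _) :=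
    hrow (i - 1) w fun q => by simp only [hw, hs]; ring_nf
  have h1 : bC b (m + 1 + 2) 1 =
      ∑ q : Fin (m + 2), bSymm b (m + 2) q * A.adjugate q (Fin.last _) := by
    rw [Matrix.sum_mul_adjugate_eq_det_updateRow, bC_eq_det_updateRow]
    congr 2
    ext q
    rw [bSymm_of_le b (by omega)]
    push_cast
    ring_nf
  have hminor := Matrix.det_leading_updateRow_mul_det A fun q => w q
  have hmi : bC b (m + 2) i = ((A.submatrix Fin.castSucc Fin.castSucc).updateRow (Fin.last m)
      fun q => w q.castSucc).det := by
    rw [bC_eq_det_updateRow, hA, bLead_submatrix_castSucc]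
    rfl
  have hm1 : bC b (m + 2) 1 = ((A.submatrix Fin.castSucc Fin.castSucc).updateRow (Fin.last m)
      fun q => A (Fin.last _) q.castSucc).det := by
    rw [bC_eq_det_updateRow, hA, bLead_submatrix_castSucc]
    congr 2
    ext q
    rw [bLead, Matrix.of_apply, bSymm_of_le b (by simp)]
    simp only [Fin.val_last, Fin.val_castSucc]
    push_cast
    ring_nf
  have hbord : bC b (m + 2 + 2) (i - 2) = w (m + 2) * A.det - ∑ q : Fin (m + 2), w q *
      ∑ p : Fin (m + 2), A.adjugate q p * bSymm b p (m + 2) := by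
    rw [bC_eq_det_updateRow, Matrix.det_eq_bordered]
    have hsub : ((bLead b (m + 2)).updateRow (Fin.last (m + 2)) fun q =>
        b ((q : ℕ) + 1) ((m + 2 : ℕ) + 1 + (i - 2) + (q : ℕ) + 1)).submatrix
        Fin.castSucc Fin.castSucc = A := by
      ext p q
      simp [Matrix.updateRow_apply, (Fin.castSucc_lt_last p).ne, hA, bLead]
    rw [hsub]
    have hv (q : ℕ) : b ((q : ℕ) + 1) ((m + 2 : ℕ) + 1 + (i - 2) + (q : ℕ) + 1) = w q := by
      simp only [hw, hs]
      push_cast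
      ring_nf
    simp only [hv, Matrix.updateRow_self, Matrix.updateRow_ne (Fin.castSucc_lt_last _).ne,
      Fin.val_last, Fin.val_castSucc, bLead, Matrix.of_apply]
  rw [← hmi, ← hm1, ← hi1, ← hlead, ← hdet] at hminor
  rw [← hbord, ← hi, ← hi1, ← h1, ← hlead, ← hdet] at key
  linear_combination bC b (m + 1 + 2) 0 * hminor + bC b (m + 2) 0 * key
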